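/- Let 0 < δ < 1 and η > 0, and for σ > 1 put σ′ = 1/(σ − 1). Then the following two-sided asymptotics hold as σ → 1⁺ (i.e., there exist constants c₁, c₂ > 0 and σ₀ ∈ (1, 2) such that the bounds hold for all 1 < σ ≤ σ₀): (i) ∑_{p≥3 prime} (log log p)^{−δ} p^{−σ} ≍ (log σ′)^{1−δ}; (ii) ∑_{p≥3 prime} (log log p)^{−1} p^{−σ} ≍ log log σ′; (iii) ∑_{p≥3 prime} (log p)(log log p)^{−η} p^{−σ} ≍ σ′ (log σ′)^{−η}. -/

import Mathlib

open Filter Chebyshev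

/-- The term `log p · φ(log p) · p ^ (-σ)` for a prime `p ≥ 3`, and `0` at all other integers. -/
noncomputable def primeTerm (φ : ℝ → ℝ) (σ : ℝ) (n : ℕ) : ℝ :=
  if n.Prime ∧ 3 ≤ n then Real.log n * φ (Real.log n) * (n : ℝ) ^ (-σ) else 0

lemma one_lt_log_of_three_le {n : ℕ} (hn : 3 ≤ n) : 1 < Real.log n := by
  have h : (3 : ℝ) ≤ n := by exact_mod_cast hn
  rw [Real.lt_log_iff_exp_lt (by linarith)]
  linarith [Real.exp_one_lt_three]

lemma primeTerm_nonneg {φ : ℝ → ℝ} (hφ : ∀ u, 1 < u → 0 ≤ φ u) (σ : ℝ) (n : ℕ) :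
    0 ≤ primeTerm φ σ n := by
  unfold primeTerm
  split_ifs with h
  · have h1 := one_lt_log_of_three_le h.2
    have h2 := hφ _ h1
    positivity
  · exact le_rfl

lemma primeTerm_le_primeTerm_zero {φ : ℝ → ℝ} (hφ : ∀ u, 1 < u → 0 ≤ φ u) {σ : ℝ} (hσ : 0 ≤ σ)
    (n : ℕ) : primeTerm φ σ n ≤ primeTerm φ 0 n := by
  unfold primeTerm
  split_ifs with h
  · have h1 := one_lt_log_of_three_le h.2
    have h2 := hφ _ h1
    have h3 : (1 : ℝ) ≤ n := by exact_mod_cast h.1.one_le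
    gcongr
  · exact le_rfl

lemma theta_eq_sum_range (x : ℝ) :
    θ x = ∑ n ∈ Finset.range (⌊x⌋₊ + 1), if n.Prime then Real.log n else 0 := by
  rw [theta_eq_sum_Icc, Finset.sum_filter, Finset.range_eq_Ico]
  rfl

/-- The number `⌊exp k⌋ + 1`, the first integer of the block `exp k < n ≤ exp (k + 1)`. -/
noncomputable def blockStart (k : ℕ) : ℕ := ⌊Real.exp k⌋₊ + 1

lemma blockStart_mono : Monotone blockStart := fun a b h => by
  unfold blockStart
  gcongr

lemma exp_lt_of_blockStart_le {k n : ℕ} (h : blockStart k ≤ n) : Real.exp k < n :=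
  (Nat.floor_lt (Real.exp_pos _).le).1 h

lemma le_exp_of_lt_blockStart {k n : ℕ} (h : n < blockStart k) : (n : ℝ) ≤ Real.exp k :=
  (Nat.le_floor_iff (Real.exp_pos _).le).1 (Nat.lt_succ_iff.1 h)

lemma le_blockStart (k : ℕ) : k ≤ blockStart k := by
  have h : k ≤ ⌊Real.exp k⌋₊ := by
    rw [Nat.le_floor_iff (Real.exp_pos _).le]
    linarith [Real.add_one_le_exp (k : ℝ)]
  exact h.trans (Nat.le_succ _)

lemma sum_block_log (k : ℕ) :
    ∑ n ∈ Finset.Ico (blockStart k) (blockStart (k + 1)), (if n.Prime then Real.log n else 0)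
      = θ (Real.exp (k + 1 : ℕ)) - θ (Real.exp k) := by
  rw [theta_eq_sum_range, theta_eq_sum_range]
  exact Finset.sum_Ico_eq_sub _ (blockStart_mono (Nat.le_succ k))

lemma eventually_le_theta : ∀ᶠ x : ℝ in atTop, 3 / 5 * x ≤ θ x := by
  obtain ⟨C, hC⟩ := psi_sub_theta_le_mul_sqrt
  have h1 : ∀ᶠ x : ℝ in atTop, Real.log (x + 2) ≤ 1 / 100 * (x + 2) :=
    (tendsto_atTop_add_const_right atTop (2 : ℝ) tendsto_id).eventually
      (by simpa using (Real.isLittleO_log_id_atTop.bound (by norm_num : (0 : ℝ) < 1 / 100)).and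
            (eventually_ge_atTop (0 : ℝ)) |>.mono (fun x hx => by
              have := hx.1
              rw [id, Real.norm_of_nonneg hx.2] at this
              exact (le_abs_self _).trans this))
  filter_upwards [h1, eventually_ge_atTop (100 : ℝ),
    eventually_ge_atTop ((100 * C) ^ 2)] with x hx1 hx2 hx3
  have h2 := psi_ge' (x := x) (by linarith)
  have h3 := hC x
  have h4 : C * √x ≤ 1 / 100 * x := by
    have h5 : 100 * C ≤ √x := Real.le_sqrt_of_sq_le hx3
    have h6 := Real.mul_self_sqrt (show 0 ≤ x by linarith)
    nlinarith [Real.sqrt_nonneg x]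
  have h5 := Real.log_two_gt_d9
  nlinarith

lemma eventually_block_bounds : ∀ᶠ k : ℕ in atTop,
    1 / 5 * Real.exp k ≤ θ (Real.exp (k + 1 : ℕ)) - θ (Real.exp k) ∧
      θ (Real.exp (k + 1 : ℕ)) - θ (Real.exp k) ≤ 4 * Real.exp k := by
  have h : Tendsto (fun k : ℕ => Real.exp (k + 1 : ℕ)) atTop atTop :=
    Real.tendsto_exp_atTop.comp (tendsto_natCast_atTop_atTop.comp (tendsto_add_atTop_nat 1))
  filter_upwards [h.eventually eventually_le_theta] with k hk
  have h1 := theta_le_log4_mul_x (Real.exp_pos (k : ℝ)).le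
  have h2 := theta_le_log4_mul_x (Real.exp_pos ((k + 1 : ℕ) : ℝ)).le
  have h3 := theta_nonneg (Real.exp k)
  have h4 : Real.log 4 = 2 * Real.log 2 := by
    rw [show (4 : ℝ) = 2 ^ 2 by norm_num, Real.log_pow]; norm_num
  have h5 := Real.log_two_lt_d9
  have h6 := Real.exp_one_gt_d9
  have h7 := Real.exp_one_lt_d9
  have h8 := Real.exp_pos (k : ℝ)
  have h9 : Real.exp (k + 1 : ℕ) = Real.exp k * Real.exp 1 := by
    rw [← Real.exp_add]; push_cast; rfl
  rw [h9] at hk h2 ⊢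
  rw [h4] at h1 h2
  have h10 := Real.log_pos one_lt_two
  constructor
  · nlinarith
  · have : 2 * Real.log 2 * Real.exp 1 ≤ 4 := by nlinarith
    nlinarith

lemma sum_block_primeTerm_bounds {φ : ℝ → ℝ} (hφ : ∀ u, 1 < u → 0 ≤ φ u)
    (hanti : AntitoneOn φ (Set.Ioi 1)) {σ : ℝ} (hσ : 0 ≤ σ) {k : ℕ} (hk : 2 ≤ k) :
    φ (k + 1 : ℕ) * Real.exp (-((k + 1 : ℕ) * σ)) *
        (θ (Real.exp (k + 1 : ℕ)) - θ (Real.exp k))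
      ≤ ∑ n ∈ Finset.Ico (blockStart k) (blockStart (k + 1)), primeTerm φ σ n ∧
    ∑ n ∈ Finset.Ico (blockStart k) (blockStart (k + 1)), primeTerm φ σ n
      ≤ φ k * Real.exp (-(k * σ)) * (θ (Real.exp (k + 1 : ℕ)) - θ (Real.exp k)) := by
  rw [← sum_block_log, Finset.mul_sum, Finset.mul_sum]
  have hk' : (2 : ℝ) ≤ k := by exact_mod_cast hk
  have key : ∀ n ∈ Finset.Ico (blockStart k) (blockStart (k + 1)), 3 ≤ n ∧
      (k : ℝ) ≤ Real.log n ∧ Real.log n ≤ (k + 1 : ℕ) ∧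
      (n : ℝ) ^ (-σ) = Real.exp (-(Real.log n * σ)) := by
    intro n hn
    rw [Finset.mem_Ico] at hn
    have h1 := exp_lt_of_blockStart_le hn.1
    have h2 := le_exp_of_lt_blockStart hn.2
    have h3 : (0 : ℝ) < n := (Real.exp_pos _).trans h1
    refine ⟨?_, ?_, ?_, ?_⟩
    · have : (2 : ℝ) < n := by linarith [Real.add_one_le_exp (k : ℝ)]
      exact_mod_cast this
    · rw [Real.le_log_iff_exp_le h3]; exact h1.le
    · rw [Real.log_le_iff_le_exp h3]; exact h2
    · rw [Real.rpow_def_of_pos h3, mul_neg]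
  constructor
  all_goals
    refine Finset.sum_le_sum fun n hn => ?_
    obtain ⟨h3, hlow, hup, hpow⟩ := key n hn
    unfold primeTerm
    by_cases hp : n.Prime
    · rw [if_pos hp, if_pos ⟨hp, h3⟩, hpow, mul_comm (Real.log _) (φ _), mul_right_comm]
      have h1 : (1 : ℝ) < Real.log n := by linarith
      have h2 := hφ _ h1
      have h4 := hφ k (by linarith)
      have h5 : φ (k + 1 : ℕ) ≤ φ (Real.log n) :=
        hanti (Set.mem_Ioi.2 h1) (Set.mem_Ioi.2 (by linarith)) hup
      have h6 : φ (Real.log n) ≤ φ k :=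
        hanti (Set.mem_Ioi.2 (by linarith)) (Set.mem_Ioi.2 h1) hlow
      gcongr
    · simp [hp]

lemma sum_range_blockStart (f : ℕ → ℝ) {K N : ℕ} (h : K ≤ N) :
    ∑ n ∈ Finset.range (blockStart N), f n = ∑ n ∈ Finset.range (blockStart K), f n +
      ∑ k ∈ Finset.Ico K N, ∑ n ∈ Finset.Ico (blockStart k) (blockStart (k + 1)), f n := by
  induction N, h using Nat.le_induction with
  | base => simp
  | succ N hN ih =>
    rw [Finset.sum_Ico_succ_top hN, ← add_assoc, ← ih,
      Finset.sum_range_add_sum_Ico _ (blockStart_mono (Nat.le_succ N))]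

/-- Comparison of the prime sum at `σ = 1 + 1 / x` with the sums of `φ k * exp (-k / x)`. -/
lemma exists_primeSum_comparison {φ : ℝ → ℝ} (hφ : ∀ u, 1 < u → 0 ≤ φ u)
    (hanti : AntitoneOn φ (Set.Ioi 1)) : ∀ᶠ K : ℕ in atTop, ∀ s : ℝ, 0 ≤ s →
      (∀ B, (∀ N, K ≤ N → ∑ k ∈ Finset.Ico K N, φ k * Real.exp (-(k * s)) ≤ B) →
        Summable (primeTerm φ (1 + s)) ∧
        ∑' n, primeTerm φ (1 + s) n ≤
          ∑ n ∈ Finset.range (blockStart K), primeTerm φ 0 n + 4 * B) ∧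
      (Summable (primeTerm φ (1 + s)) → ∀ N, K ≤ N →
        1 / (5 * Real.exp 1) *
          ∑ k ∈ Finset.Ico K N, φ (k + 1 : ℕ) * Real.exp (-((k + 1 : ℕ) * s))
          ≤ ∑' n, primeTerm φ (1 + s) n) := by
  obtain ⟨K₀, hK₀⟩ := eventually_atTop.1 eventually_block_bounds
  filter_upwards [eventually_ge_atTop K₀, eventually_ge_atTop 2] with K hK hK2 s hs
  have hσ : 0 ≤ 1 + s := by linarith
  have hnn := primeTerm_nonneg hφ (1 + s)
  constructor
  · intro B hB
    have hpart : ∀ n, ∑ i ∈ Finset.range n, primeTerm φ (1 + s) i ≤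
        ∑ n ∈ Finset.range (blockStart K), primeTerm φ 0 n + 4 * B := by
      intro n
      calc ∑ i ∈ Finset.range n, primeTerm φ (1 + s) i
          ≤ ∑ i ∈ Finset.range (blockStart (max n K)), primeTerm φ (1 + s) i :=
            Finset.sum_le_sum_of_subset_of_nonneg
              (Finset.range_mono ((le_max_left n K).trans (le_blockStart _)))
              (fun i _ _ => hnn i)
        _ = ∑ i ∈ Finset.range (blockStart K), primeTerm φ (1 + s) i +
            ∑ k ∈ Finset.Ico K (max n K),
              ∑ i ∈ Finset.Ico (blockStart k) (blockStart (k + 1)), primeTerm φ (1 + s) i :=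
            sum_range_blockStart _ (le_max_right n K)
        _ ≤ ∑ i ∈ Finset.range (blockStart K), primeTerm φ 0 i +
            ∑ k ∈ Finset.Ico K (max n K), 4 * (φ k * Real.exp (-(k * s))) := by
            refine add_le_add (Finset.sum_le_sum fun i _ => primeTerm_le_primeTerm_zero hφ hσ i)
              (Finset.sum_le_sum fun k hk => ?_)
            have hkK := (Finset.mem_Ico.1 hk).1
            refine (sum_block_primeTerm_bounds hφ hanti hσ (hK2.trans hkK)).2.trans ?_
            have h1 := (hK₀ k (hK.trans hkK)).2
            have h2 : 0 ≤ φ k := hφ _ (by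
              have : (2 : ℝ) ≤ k := by exact_mod_cast hK2.trans hkK
              linarith)
            have h3 : Real.exp (-(k * (1 + s))) * Real.exp k = Real.exp (-(k * s)) := by
              rw [← Real.exp_add]; ring_nf
            rw [← h3]
            calc _ ≤ φ k * Real.exp (-(k * (1 + s))) * (4 * Real.exp k) := by gcongr
              _ = _ := by ring
        _ ≤ _ := by
            rw [← Finset.mul_sum]
            gcongr
            exact hB _ (le_max_right n K)
    exact ⟨summable_of_sum_range_le hnn hpart, Real.tsum_le_of_sum_range_le hnn hpart⟩
  · intro hsum N hN
    calc _ ≤ ∑ k ∈ Finset.Ico K N,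
              ∑ i ∈ Finset.Ico (blockStart k) (blockStart (k + 1)), primeTerm φ (1 + s) i := by
            rw [Finset.mul_sum]
            refine Finset.sum_le_sum fun k hk => ?_
            have hkK := (Finset.mem_Ico.1 hk).1
            refine le_trans ?_ (sum_block_primeTerm_bounds hφ hanti hσ (hK2.trans hkK)).1
            have h1 := (hK₀ k (hK.trans hkK)).1
            have h2 : 0 ≤ φ (k + 1 : ℕ) := hφ _ (by
              have : (2 : ℝ) ≤ k := by exact_mod_cast hK2.trans hkK
              push_cast
              linarith)
            have h3 : Real.exp (-((k + 1 : ℕ) * (1 + s))) * Real.exp k * Real.exp 1 =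
                Real.exp (-((k + 1 : ℕ) * s)) := by
              rw [← Real.exp_add, ← Real.exp_add]; push_cast; ring_nf
            rw [← h3]
            calc _ = φ (k + 1 : ℕ) * Real.exp (-((k + 1 : ℕ) * (1 + s))) *
                  (1 / 5 * Real.exp k) := by
                  field_simp
              _ ≤ _ := by gcongr
      _ ≤ ∑ i ∈ Finset.range (blockStart N), primeTerm φ (1 + s) i := by
            rw [sum_range_blockStart _ hN]
            exact le_add_of_nonneg_left (Finset.sum_nonneg fun i _ => hnn i)
      _ ≤ _ := hsum.sum_le_tsum _ (fun i _ => hnn i)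

section Primitive

variable {φ G g : ℝ → ℝ} {U a b : ℝ}

lemma sub_bounds_of_hasDerivAt (hU : 1 < U) (hanti : AntitoneOn φ (Set.Ioi 1))
    (hG : ∀ u, U ≤ u → HasDerivAt G (g u) u) (ha : 0 < a) (hb : 0 < b)
    (hag : ∀ u, U ≤ u → a * φ u ≤ g u) (hgb : ∀ u, U ≤ u → g u ≤ b * φ u)
    {u : ℝ} (hu : U ≤ u) :
    a * φ (u + 1) ≤ G (u + 1) - G u ∧ G (u + 1) - G u ≤ b * φ u := by
  obtain ⟨c, ⟨hc1, hc2⟩, hc⟩ := exists_hasDerivAt_eq_slope G g (lt_add_one u)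
    (fun v hv => (hG v (hu.trans hv.1)).continuousAt.continuousWithinAt)
    (fun v hv => hG v (hu.trans hv.1.le))
  rw [add_sub_cancel_left, div_one] at hc
  rw [← hc]
  have hUc : U ≤ c := hu.trans hc1.le
  have h1 : φ (u + 1) ≤ φ c :=
    hanti (Set.mem_Ioi.2 (by linarith)) (Set.mem_Ioi.2 (by linarith)) hc2.le
  have h2 : φ c ≤ φ u :=
    hanti (Set.mem_Ioi.2 (by linarith)) (Set.mem_Ioi.2 (by linarith)) hc1.le
  exact ⟨(mul_le_mul_of_nonneg_left h1 ha.le).trans (hag c hUc),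
    (hgb c hUc).trans (mul_le_mul_of_nonneg_left h2 hb.le)⟩

lemma sum_geometric_le {x : ℝ} (hx : 1 ≤ x) (K N : ℕ) :
    ∑ k ∈ Finset.Ico K N, Real.exp (-(k * (1 / x))) ≤ 2 * x := by
  have hs : 0 < 1 / x := by positivity
  set r := Real.exp (-(1 / x)) with hr
  have hr0 : 0 ≤ r := (Real.exp_pos _).le
  have hr1 : r < 1 := by rw [hr, Real.exp_lt_one_iff]; linarith
  have h1 : ∑ k ∈ Finset.Ico K N, Real.exp (-(k * (1 / x))) = ∑ k ∈ Finset.Ico K N, r ^ k :=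
    Finset.sum_congr rfl fun k _ => by rw [hr, ← Real.exp_nat_mul, mul_neg]
  have h2 : ∑ k ∈ Finset.Ico K N, r ^ k ≤ (1 - r)⁻¹ := by
    rw [← tsum_geometric_of_lt_one hr0 hr1]
    exact (summable_geometric_of_lt_one hr0 hr1).sum_le_tsum _ (fun i _ => by positivity)
  rw [h1]
  refine h2.trans ?_
  have h3 : r * Real.exp (1 / x) = 1 := by rw [hr, ← Real.exp_add]; simp
  have h4 := Real.add_one_le_exp (1 / x)
  have h5 : r * (1 / x + 1) ≤ 1 := (mul_le_mul_of_nonneg_left h4 hr0).trans_eq h3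
  have h6 : r * (1 + x) ≤ x := by
    have : r * (1 + x) = r * (1 / x + 1) * x := by field_simp
    rw [this]
    nlinarith
  rw [inv_le_iff_one_le_mul₀ (by linarith)]
  nlinarith

/-- If `G` is a primitive of a function comparable to the decreasing weight `φ`, then
`∑ log p · φ(log p) · p ^ (-(1 + 1 / x)) ≍ G x` as `x → ∞`. -/
theorem primeSum_asymp (hU : 1 < U) (hφ : ∀ u, 1 < u → 0 ≤ φ u)
    (hanti : AntitoneOn φ (Set.Ioi 1))
    (hG : ∀ u, U ≤ u → HasDerivAt G (g u) u) (ha : 0 < a) (hb : 0 < b)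
    (hag : ∀ u, U ≤ u → a * φ u ≤ g u) (hgb : ∀ u, U ≤ u → g u ≤ b * φ u)
    (hGtop : Tendsto G atTop atTop) (hφG : ∀ᶠ x in atTop, x * φ x ≤ G x) :
    ∃ c₁ c₂ : ℝ, 0 < c₁ ∧ 0 < c₂ ∧ ∀ᶠ x in atTop,
      c₁ * G x ≤ ∑' n, primeTerm φ (1 + 1 / x) n ∧
      ∑' n, primeTerm φ (1 + 1 / x) n ≤ c₂ * G x := by
  obtain ⟨K, hcomp, hKU, hK2⟩ := ((exists_primeSum_comparison hφ hanti).and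
    ((tendsto_natCast_atTop_atTop.eventually (eventually_ge_atTop U)).and
      (eventually_ge_atTop 2))).exists
  have hmono : ∀ u v, U ≤ u → u ≤ v → G u ≤ G v := by
    have : MonotoneOn G (Set.Ici U) := by
      refine monotoneOn_of_deriv_nonneg (convex_Ici U)
        (fun v hv => (hG v hv).continuousAt.continuousWithinAt) (fun v hv => ?_) (fun v hv => ?_)
      · rw [interior_Ici] at hv
        exact (hG v (le_of_lt hv)).differentiableAt.differentiableWithinAt
      · rw [interior_Ici] at hv
        have hv' : U < v := hv
        rw [(hG v hv'.le).deriv]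
        exact (mul_nonneg ha.le (hφ v (hU.trans hv'))).trans (hag v hv'.le)
    exact fun u v hu huv => this hu (hu.trans huv) huv
  have hstep := fun u (hu : U ≤ u) => sub_bounds_of_hasDerivAt hU hanti hG ha hb hag hgb hu
  have hupper : ∀ N, K ≤ N → a * ∑ k ∈ Finset.Ico K N, φ (k + 1 : ℕ) ≤ G N - G K := by
    intro N hN
    rw [Finset.mul_sum, ← Finset.sum_Ico_sub (fun k : ℕ => G k) hN]
    refine Finset.sum_le_sum fun k hk => ?_
    have hk' : U ≤ (k : ℝ) := hKU.trans (by exact_mod_cast (Finset.mem_Ico.1 hk).1)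
    simpa using (hstep k hk').1
  have hlower : ∀ N, K ≤ N →
      G (N + 1) - G (K + 1) ≤ b * ∑ k ∈ Finset.Ico K N, φ (k + 1 : ℕ) := by
    intro N hN
    have h := Finset.sum_Ico_sub (fun k : ℕ => G (k + 1)) hN
    rw [Finset.mul_sum, ← h]
    refine Finset.sum_le_sum fun k hk => ?_
    have hk' : U ≤ (k : ℝ) := hKU.trans (by exact_mod_cast (Finset.mem_Ico.1 hk).1)
    simpa using (hstep (k + 1) (by linarith)).2
  set H := ∑ n ∈ Finset.range (blockStart K), primeTerm φ 0 n with hH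
  have hH0 : 0 ≤ H := Finset.sum_nonneg fun n _ => primeTerm_nonneg hφ 0 n
  have hK1 : (1 : ℝ) < K := by exact_mod_cast hK2
  have hφK : 0 ≤ φ K := hφ _ hK1
  refine ⟨1 / (5 * Real.exp 1) * (Real.exp (-1) * (1 / (2 * b))),
    H + 4 * (φ K + (1 + |G K|) / a + 2), by positivity, by positivity, ?_⟩
  filter_upwards [hφG, hGtop.eventually_ge_atTop 1, hGtop.eventually_ge_atTop (2 * G (K + 1)),
    eventually_ge_atTop (K : ℝ)] with x hxφ hx1 hx2 hxK
  have hx0 : 0 < x := by linarith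
  have hKx : K ≤ ⌊x⌋₊ := Nat.le_floor hxK
  have hφx : 0 ≤ φ x := hφ _ (by linarith)
  have hs : 0 ≤ 1 / x := by positivity
  have hB : ∀ N, K ≤ N → ∑ k ∈ Finset.Ico K N, φ k * Real.exp (-(k * (1 / x))) ≤
      (φ K + (G x - G K) / a) + 2 * G x := by
    intro N _
    calc ∑ k ∈ Finset.Ico K N, φ k * Real.exp (-(k * (1 / x)))
        ≤ ∑ k ∈ Finset.Ico K N,
            ((if k < ⌊x⌋₊ + 1 then φ k else 0) + φ x * Real.exp (-(k * (1 / x)))) := by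
          refine Finset.sum_le_sum fun k hk => ?_
          have hk1 : (1 : ℝ) < k := hK1.trans_le (by exact_mod_cast (Finset.mem_Ico.1 hk).1)
          have hφk : 0 ≤ φ k := hφ _ hk1
          split_ifs with h
          · have h1 : Real.exp (-(k * (1 / x))) ≤ 1 := by
              rw [Real.exp_le_one_iff]
              have : 0 ≤ (k : ℝ) * (1 / x) := by positivity
              linarith
            have h2 : 0 ≤ φ x * Real.exp (-(k * (1 / x))) := by positivity
            nlinarith
          · have hxk : x ≤ k := by
              have h1 : ⌊x⌋₊ + 1 ≤ k := not_lt.1 h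
              have h2 : ((⌊x⌋₊ : ℝ) + 1) ≤ k := by exact_mod_cast h1
              linarith [Nat.lt_floor_add_one x]
            rw [zero_add]
            have : φ k ≤ φ x := hanti (Set.mem_Ioi.2 (by linarith)) (Set.mem_Ioi.2 hk1) hxk
            gcongr
      _ = ∑ k ∈ Finset.Ico K N with k < ⌊x⌋₊ + 1, φ k +
            φ x * ∑ k ∈ Finset.Ico K N, Real.exp (-(k * (1 / x))) := by
          rw [Finset.sum_add_distrib, ← Finset.mul_sum, Finset.sum_filter]
      _ ≤ ∑ k ∈ Finset.Ico K (⌊x⌋₊ + 1), φ k + φ x * (2 * x) := by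
          refine add_le_add (Finset.sum_le_sum_of_subset_of_nonneg (fun k hk => ?_) fun k hk _ => ?_)
            (mul_le_mul_of_nonneg_left (sum_geometric_le (by linarith) K N) hφx)
          · rw [Finset.mem_filter, Finset.mem_Ico] at hk
            exact Finset.mem_Ico.2 ⟨hk.1.1, hk.2⟩
          · exact hφ _ (hK1.trans_le (by exact_mod_cast (Finset.mem_Ico.1 hk).1))
      _ ≤ _ := by
          rw [Finset.sum_eq_sum_Ico_succ_bot (Nat.lt_succ_of_le hKx),
            ← Finset.sum_Ico_add' (fun k : ℕ => φ k) K ⌊x⌋₊ 1]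
          have h1 := hupper _ hKx
          have h2 : G ⌊x⌋₊ ≤ G x :=
            hmono _ _ (hKU.trans (by exact_mod_cast hKx)) (Nat.floor_le hx0.le)
          have h3 : ∑ k ∈ Finset.Ico K ⌊x⌋₊, φ (k + 1 : ℕ) ≤ (G x - G K) / a := by
            rw [le_div_iff₀ ha]
            linarith
          linarith
  obtain ⟨hsum, hup⟩ := (hcomp (1 / x) hs).1 _ hB
  refine ⟨?_, hup.trans ?_⟩
  · refine le_trans ?_ ((hcomp (1 / x) hs).2 hsum _ hKx)
    rw [mul_assoc]
    refine mul_le_mul_of_nonneg_left ?_ (by positivity)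
    have h1 := hlower _ hKx
    have h2 : G x ≤ G (⌊x⌋₊ + 1) := hmono _ _ (by linarith) (Nat.lt_floor_add_one x).le
    have h3 : 1 / (2 * b) * G x ≤ ∑ k ∈ Finset.Ico K ⌊x⌋₊, φ (k + 1 : ℕ) := by
      rw [one_div, inv_mul_le_iff₀ (by positivity)]
      linarith
    calc _ = Real.exp (-1) * (1 / (2 * b) * G x) := by ring
      _ ≤ Real.exp (-1) * ∑ k ∈ Finset.Ico K ⌊x⌋₊, φ (k + 1 : ℕ) := by gcongr
      _ ≤ _ := by
        rw [Finset.mul_sum]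
        refine Finset.sum_le_sum fun k hk => ?_
        obtain ⟨hk1, hk2⟩ := Finset.mem_Ico.1 hk
        have hφk : 0 ≤ φ (k + 1 : ℕ) := hφ _ (hK1.trans_le (by exact_mod_cast hk1.trans k.le_succ))
        have hkx : ((k + 1 : ℕ) : ℝ) ≤ x := (Nat.le_floor_iff hx0.le).1 hk2
        have : ((k + 1 : ℕ) : ℝ) * (1 / x) ≤ 1 := by
          rw [mul_one_div, div_le_one hx0]; exact hkx
        rw [mul_comm]
        gcongr
  · have h1 : (G x - G K) / a ≤ (1 + |G K|) / a * G x := by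
      rw [div_mul_eq_mul_div]
      gcongr
      nlinarith [neg_abs_le (G K), abs_nonneg (G K)]
    nlinarith

end Primitive

lemma antitoneOn_log_rpow_neg {c : ℝ} (hc : 0 ≤ c) :
    AntitoneOn (fun u => Real.log u ^ (-c)) (Set.Ioi 1) := by
  intro u hu v hv huv
  have hu' : (1 : ℝ) < u := hu
  exact Real.rpow_le_rpow_of_nonpos (Real.log_pos hu')
    (Real.log_le_log (by linarith) huv) (by linarith)

lemma antitoneOn_inv_mul_log_rpow_neg {c : ℝ} (hc : 0 ≤ c) :
    AntitoneOn (fun u => u⁻¹ * Real.log u ^ (-c)) (Set.Ioi 1) := by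
  intro u hu v hv huv
  have hu' : (1 : ℝ) < u := hu
  have hv' : (1 : ℝ) < v := hv
  have h := antitoneOn_log_rpow_neg hc hu hv huv
  have h1 := Real.rpow_nonneg (Real.log_pos hv').le (-c)
  have h2 : v⁻¹ ≤ u⁻¹ := inv_anti₀ (by linarith) huv
  exact mul_le_mul h2 h h1 (by positivity)

lemma inv_mul_log_rpow_neg_nonneg (c u : ℝ) (hu : 1 < u) : 0 ≤ u⁻¹ * Real.log u ^ (-c) := by
  have := Real.rpow_nonneg (Real.log_pos hu).le (-c)
  positivity

lemma hasDerivAt_log_rpow (c : ℝ) {u : ℝ} (hu : 1 < u) :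
    HasDerivAt (fun u => Real.log u ^ c) (u⁻¹ * c * Real.log u ^ (c - 1)) u :=
  (Real.hasDerivAt_log (by linarith)).rpow_const (Or.inl (Real.log_pos hu).ne')

lemma tendsto_mul_log_rpow_neg_atTop (c : ℝ) :
    Tendsto (fun x => x * Real.log x ^ (-c)) atTop atTop := by
  refine ((tendsto_exp_div_rpow_atTop c).comp Real.tendsto_log_atTop).congr' ?_
  filter_upwards [eventually_gt_atTop 1] with x hx
  rw [Function.comp_apply, Real.exp_log (by linarith), Real.rpow_neg (Real.log_pos hx).le,
    div_eq_mul_inv]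

theorem primeSum_inv_mul_log_rpow_asymp {δ : ℝ} (hδ0 : 0 < δ) (hδ1 : δ < 1) :
    ∃ c₁ c₂ : ℝ, 0 < c₁ ∧ 0 < c₂ ∧ ∀ᶠ x in atTop,
      c₁ * Real.log x ^ (1 - δ) ≤
        ∑' n, primeTerm (fun u => u⁻¹ * Real.log u ^ (-δ)) (1 + 1 / x) n ∧
      ∑' n, primeTerm (fun u => u⁻¹ * Real.log u ^ (-δ)) (1 + 1 / x) n ≤
        c₂ * Real.log x ^ (1 - δ) := by
  have h1 : 0 < 1 - δ := by linarith
  have heq : ∀ u : ℝ, u⁻¹ * (1 - δ) * Real.log u ^ (1 - δ - 1) =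
      (1 - δ) * (u⁻¹ * Real.log u ^ (-δ)) := fun u => by
    rw [show 1 - δ - 1 = -δ by ring]; ring
  refine primeSum_asymp (U := 2) (G := fun u => Real.log u ^ (1 - δ)) one_lt_two
    (inv_mul_log_rpow_neg_nonneg δ)
    (antitoneOn_inv_mul_log_rpow_neg hδ0.le) (fun u hu => hasDerivAt_log_rpow _ (by linarith))
    h1 h1 (fun u _ => (heq u).ge) (fun u _ => (heq u).le)
    ((tendsto_rpow_atTop h1).comp Real.tendsto_log_atTop) ?_
  filter_upwards [Real.tendsto_log_atTop.eventually_ge_atTop 1, eventually_gt_atTop 0] with x hx hx0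
  rw [mul_inv_cancel_left₀ hx0.ne']
  exact Real.rpow_le_rpow_of_exponent_le hx (by linarith)

theorem primeSum_inv_mul_log_inv_asymp :
    ∃ c₁ c₂ : ℝ, 0 < c₁ ∧ 0 < c₂ ∧ ∀ᶠ x in atTop,
      c₁ * Real.log (Real.log x) ≤
        ∑' n, primeTerm (fun u => u⁻¹ * Real.log u ^ (-1 : ℝ)) (1 + 1 / x) n ∧
      ∑' n, primeTerm (fun u => u⁻¹ * Real.log u ^ (-1 : ℝ)) (1 + 1 / x) n ≤
        c₂ * Real.log (Real.log x) := by
  have heq : ∀ u : ℝ, u⁻¹ / Real.log u = 1 * (u⁻¹ * Real.log u ^ (-1 : ℝ)) := fun u => by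
    rw [Real.rpow_neg_one, one_mul, div_eq_mul_inv]
  refine primeSum_asymp (U := 2) (G := fun u => Real.log (Real.log u)) one_lt_two
    (inv_mul_log_rpow_neg_nonneg 1)
    (antitoneOn_inv_mul_log_rpow_neg zero_le_one)
    (fun u hu => (Real.hasDerivAt_log (by linarith)).log (Real.log_pos (by linarith)).ne')
    one_pos one_pos (fun u _ => (heq u).ge) (fun u _ => (heq u).le)
    (Real.tendsto_log_atTop.comp Real.tendsto_log_atTop) ?_
  filter_upwards [Real.tendsto_log_atTop.eventually_ge_atTop 1, eventually_gt_atTop 0,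
    (Real.tendsto_log_atTop.comp Real.tendsto_log_atTop).eventually_ge_atTop 1] with x hx hx0 hx1
  rw [mul_inv_cancel_left₀ hx0.ne', Real.rpow_neg_one]
  exact (inv_le_one_of_one_le₀ hx).trans hx1

theorem primeSum_log_rpow_asymp {η : ℝ} (hη : 0 < η) :
    ∃ c₁ c₂ : ℝ, 0 < c₁ ∧ 0 < c₂ ∧ ∀ᶠ x in atTop,
      c₁ * (x * Real.log x ^ (-η)) ≤
        ∑' n, primeTerm (fun u => Real.log u ^ (-η)) (1 + 1 / x) n ∧
      ∑' n, primeTerm (fun u => Real.log u ^ (-η)) (1 + 1 / x) n ≤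
        c₂ * (x * Real.log x ^ (-η)) := by
  have hU : 1 < Real.exp (2 * η) := Real.one_lt_exp_iff.2 (by linarith)
  have hderiv : ∀ u, Real.exp (2 * η) ≤ u →
      HasDerivAt (fun u => u * Real.log u ^ (-η))
        (Real.log u ^ (-η) * (1 - η / Real.log u)) u := by
    intro u hu
    have hu1 : 1 < u := hU.trans_le hu
    have hl := Real.log_pos hu1
    have hu0 : u ≠ 0 := by linarith
    refine ((hasDerivAt_id' u).fun_mul (hasDerivAt_log_rpow (-η) hu1)).congr_deriv ?_
    rw [Real.rpow_sub_one hl.ne']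
    field_simp
    ring
  have hφ : ∀ u : ℝ, 1 < u → 0 ≤ Real.log u ^ (-η) :=
    fun u hu => Real.rpow_nonneg (Real.log_pos hu).le _
  refine primeSum_asymp (G := fun u => u * Real.log u ^ (-η)) hU hφ
    (antitoneOn_log_rpow_neg hη.le) hderiv one_half_pos one_pos (fun u hu => ?_) (fun u hu => ?_)
    (tendsto_mul_log_rpow_neg_atTop η) (Eventually.of_forall fun x => le_rfl)
  all_goals
    have hu1 : 1 < u := hU.trans_le hu
    have hl := Real.log_pos hu1
    have h1 := hφ u hu1
  · have h2 : 2 * η ≤ Real.log u := (Real.le_log_iff_exp_le (by linarith)).2 hu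
    have h3 : η / Real.log u ≤ 1 / 2 := by
      rw [div_le_iff₀ hl]; linarith
    nlinarith
  · have h3 : 0 ≤ η / Real.log u := by positivity
    nlinarith

lemma primeTerm_inv_mul (f : ℝ → ℝ) (σ : ℝ) (n : ℕ) :
    primeTerm (fun u => u⁻¹ * f u) σ n =
      if n.Prime ∧ 3 ≤ n then f (Real.log n) * (n : ℝ) ^ (-σ) else 0 := by
  unfold primeTerm
  split_ifs with h
  · rw [mul_inv_cancel_left₀ (by linarith [one_lt_log_of_three_le h.2])]
  · rfl


/-- For `0 < δ < 1`, `η > 0` and `σ′ = 1/(σ−1)`, as `σ → 1⁺`: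
(i) `∑_{p≥3} (log log p)^{−δ} p^{−σ} ≍ (log σ′)^{1−δ}`;
(ii) `∑_{p≥3} (log log p)^{−1} p^{−σ} ≍ log log σ′`;
(iii) `∑_{p≥3} (log p)(log log p)^{−η} p^{−σ} ≍ σ′ (log σ′)^{−η}`. -/
theorem statement16 (δ η : ℝ) (hδ0 : 0 < δ) (hδ1 : δ < 1) (hη : 0 < η) :
    ∃ c₁ c₂ σ₀ : ℝ, 0 < c₁ ∧ 0 < c₂ ∧ 1 < σ₀ ∧ σ₀ < 2 ∧
      ∀ σ : ℝ, 1 < σ → σ ≤ σ₀ →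
        (c₁ * (Real.log (1 / (σ - 1))) ^ (1 - δ)
            ≤ (∑' n : ℕ, if n.Prime ∧ 3 ≤ n then
                (Real.log (Real.log n)) ^ (-δ) * (n : ℝ) ^ (-σ) else 0) ∧
          (∑' n : ℕ, if n.Prime ∧ 3 ≤ n then
              (Real.log (Real.log n)) ^ (-δ) * (n : ℝ) ^ (-σ) else 0)
            ≤ c₂ * (Real.log (1 / (σ - 1))) ^ (1 - δ)) ∧
        (c₁ * Real.log (Real.log (1 / (σ - 1)))
            ≤ (∑' n : ℕ, if n.Prime ∧ 3 ≤ n then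
                (Real.log (Real.log n))⁻¹ * (n : ℝ) ^ (-σ) else 0) ∧
          (∑' n : ℕ, if n.Prime ∧ 3 ≤ n then
              (Real.log (Real.log n))⁻¹ * (n : ℝ) ^ (-σ) else 0)
            ≤ c₂ * Real.log (Real.log (1 / (σ - 1)))) ∧
        (c₁ * ((1 / (σ - 1)) * (Real.log (1 / (σ - 1))) ^ (-η))
            ≤ (∑' n : ℕ, if n.Prime ∧ 3 ≤ n then
                Real.log n * (Real.log (Real.log n)) ^ (-η) * (n : ℝ) ^ (-σ) else 0) ∧
          (∑' n : ℕ, if n.Prime ∧ 3 ≤ n then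
              Real.log n * (Real.log (Real.log n)) ^ (-η) * (n : ℝ) ^ (-σ) else 0)
            ≤ c₂ * ((1 / (σ - 1)) * (Real.log (1 / (σ - 1))) ^ (-η))) := by
  obtain ⟨a₁, b₁, ha₁, hb₁, h₁⟩ := primeSum_inv_mul_log_rpow_asymp hδ0 hδ1
  obtain ⟨a₂, b₂, ha₂, hb₂, h₂⟩ := primeSum_inv_mul_log_inv_asymp
  obtain ⟨a₃, b₃, ha₃, hb₃, h₃⟩ := primeSum_log_rpow_asymp hη
  have hl := (Real.tendsto_log_atTop.comp Real.tendsto_log_atTop).eventually_ge_atTop 0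
  obtain ⟨X, hX⟩ := eventually_atTop.1 (h₁.and (h₂.and (h₃.and
    (hl.and (Real.tendsto_log_atTop.eventually_ge_atTop 0)))))
  have hX' : 2 ≤ max X 2 := le_max_right X 2
  refine ⟨min a₁ (min a₂ a₃), max b₁ (max b₂ b₃), 1 + 1 / max X 2, by positivity, by positivity,
    by linarith [show 0 < 1 / max X 2 by positivity], ?_, fun σ hσ hσX => ?_⟩
  · have : 1 / max X 2 ≤ 1 / 2 := by gcongr
    linarith
  have hs : 0 < σ - 1 := by linarith
  have hx : X ≤ 1 / (σ - 1) := (le_max_left X 2).trans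
    ((le_one_div hs (by positivity)).1 (by linarith))
  have hσx : 1 + 1 / (1 / (σ - 1)) = σ := by rw [one_div_one_div]; ring
  obtain ⟨hi, hii, hiii, hll, hlog⟩ := hX _ hx
  have hx0 : 0 < 1 / (σ - 1) := by positivity
  rw [hσx] at hi hii hiii
  simp only [primeTerm_inv_mul (fun u => Real.log u ^ (-δ))] at hi
  simp only [primeTerm_inv_mul (fun u => Real.log u ^ (-1 : ℝ))] at hii
  simp only [Real.rpow_neg_one] at hii
  simp only [primeTerm] at hiii
  rw [Function.comp_apply] at hll
  set x := 1 / (σ - 1)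
  have g₁ : 0 ≤ Real.log x ^ (1 - δ) := Real.rpow_nonneg hlog _
  have g₃ : 0 ≤ x * Real.log x ^ (-η) := mul_nonneg hx0.le (Real.rpow_nonneg hlog _)
  refine ⟨⟨le_trans ?_ hi.1, hi.2.trans ?_⟩, ⟨le_trans ?_ hii.1, hii.2.trans ?_⟩,
    ⟨le_trans ?_ hiii.1, hiii.2.trans ?_⟩⟩
  all_goals
    gcongr
    simp
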